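/- arXiv:0710.0872 — 2 statements merged into one kernel-verified Lean document; each statement's English description precedes it below -/
import Mathlib

section
/- Let b > 0, δ > 0, η > 0 and 0 ≤ v < 1 be real constants, and let y : [0,1] × [0,∞) → ℝ be a sufficiently smooth (of class C³) solution of the PDE y_tt + 2δ y_t + 2v y_xt = (1 − v² + (3/2) b y_x²) y_xx + 2η y_x y_xx y_xt + η y_x² y_xxt on (0,1) × [0,∞) with boundary conditions y(0,t) = y(1,t) = 0 for all t ≥ 0. Define E(t) = ∫₀¹ [ (1/2) y_t² + (1/2)(1−v²) y_x² + (b/8) y_x⁴ ] dx and V(t) = E(t) + δ ∫₀¹ [ y y_t + δ y² + (η/4) y_x⁴ ] dx. Then t ↦ V(t) is differentiable on [0,∞) and for every t ≥ 0, V′(t) ≤ −2δ (1 − v − v²)/(1 − v²) · E(t). -/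
open Real

/-- Partial derivative with respect to the first (spatial) variable. -/
noncomputable def pdx (y : ℝ → ℝ → ℝ) (x t : ℝ) : ℝ := deriv (fun x' => y x' t) x

/-- Partial derivative with respect to the second (time) variable. -/
noncomputable def pdt (y : ℝ → ℝ → ℝ) (x t : ℝ) : ℝ := deriv (fun t' => y x t') t

open MeasureTheory Set Function in
/-- Differentiation under the integral sign over a compact interval, for a jointly continuous
integrand with jointly continuous derivative in the parameter. -/
theorem hasDerivAt_intervalIntegral_of_continuous {F F' : ℝ → ℝ → ℝ} (a b : ℝ)
    (hF : Continuous (uncurry F)) (hF' : Continuous (uncurry F'))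
    (h : ∀ x t, HasDerivAt (F x) (F' x t) t) (t : ℝ) :
    HasDerivAt (fun s => ∫ x in a..b, F x s) (∫ x in a..b, F' x t) t := by
  have hslice {f : ℝ → ℝ → ℝ} (hf : Continuous (uncurry f)) (s : ℝ) :
      Continuous fun x => f x s :=
    hf.comp (continuous_id.prodMk continuous_const)
  obtain ⟨C, hC⟩ := (isCompact_uIcc.prod (isCompact_closedBall t 1)).exists_bound_of_continuousOn
    (s := uIcc a b ×ˢ Metric.closedBall t 1) hF'.continuousOn
  refine (intervalIntegral.hasDerivAt_integral_of_dominated_loc_of_deriv_le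
    (F := fun s x => F x s) (F' := fun s x => F' x s) (bound := fun _ => C)
    (Metric.closedBall_mem_nhds t one_pos)
    (.of_forall fun s => (hslice hF s).aestronglyMeasurable)
    ((hslice hF t).intervalIntegrable _ _) (hslice hF' t).aestronglyMeasurable
    (.of_forall fun x hx s hs => hC (x, s) ⟨uIoc_subset_uIcc hx, hs⟩)
    intervalIntegrable_const (.of_forall fun x _ s _ => h x s)).2

section PartialDerivatives

open Function

variable {y : ℝ → ℝ → ℝ}

theorem hasDerivAt_slice_fst (hy : Differentiable ℝ (uncurry y)) (x t : ℝ) :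
    HasDerivAt (fun x' => y x' t) (fderiv ℝ (uncurry y) (x, t) (1, 0)) x :=
  HasFDerivAt.comp_hasDerivAt (f := fun x' => (x', t)) x (hy (x, t)).hasFDerivAt
    ((hasDerivAt_id' x).prodMk (hasDerivAt_const x t))

theorem hasDerivAt_slice_snd (hy : Differentiable ℝ (uncurry y)) (x t : ℝ) :
    HasDerivAt (y x) (fderiv ℝ (uncurry y) (x, t) (0, 1)) t :=
  HasFDerivAt.comp_hasDerivAt (f := fun t' => (x, t')) t (hy (x, t)).hasFDerivAt
    ((hasDerivAt_const t x).prodMk (hasDerivAt_id' t))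

theorem hasDerivAt_pdx (hy : Differentiable ℝ (uncurry y)) (x t : ℝ) :
    HasDerivAt (fun x' => y x' t) (pdx y x t) x :=
  (hasDerivAt_slice_fst hy x t).differentiableAt.hasDerivAt

theorem hasDerivAt_pdt (hy : Differentiable ℝ (uncurry y)) (x t : ℝ) :
    HasDerivAt (y x) (pdt y x t) t :=
  (hasDerivAt_slice_snd hy x t).differentiableAt.hasDerivAt

theorem uncurry_pdx_eq_fderiv (hy : Differentiable ℝ (uncurry y)) :
    uncurry (pdx y) = fun z => fderiv ℝ (uncurry y) z (1, 0) :=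
  funext fun z => (hasDerivAt_slice_fst hy z.1 z.2).deriv

theorem uncurry_pdt_eq_fderiv (hy : Differentiable ℝ (uncurry y)) :
    uncurry (pdt y) = fun z => fderiv ℝ (uncurry y) z (0, 1) :=
  funext fun z => (hasDerivAt_slice_snd hy z.1 z.2).deriv

theorem ContDiff.uncurry_pdx {m n : WithTop ℕ∞} (hy : ContDiff ℝ n (uncurry y)) (hmn : m + 1 ≤ n) :
    ContDiff ℝ m (uncurry (pdx y)) := by
  rw [uncurry_pdx_eq_fderiv ((hy.of_le (le_add_self.trans hmn)).differentiable one_ne_zero)]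
  exact (hy.fderiv_right hmn).clm_apply contDiff_const

theorem ContDiff.uncurry_pdt {m n : WithTop ℕ∞} (hy : ContDiff ℝ n (uncurry y)) (hmn : m + 1 ≤ n) :
    ContDiff ℝ m (uncurry (pdt y)) := by
  rw [uncurry_pdt_eq_fderiv ((hy.of_le (le_add_self.trans hmn)).differentiable one_ne_zero)]
  exact (hy.fderiv_right hmn).clm_apply contDiff_const

/-- Mixed partial derivatives of a `C²` function commute. -/
theorem pdt_pdx_eq_pdx_pdt (hy : ContDiff ℝ 2 (uncurry y)) : pdt (pdx y) = pdx (pdt y) := by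
  have hd : Differentiable ℝ (uncurry y) := hy.differentiable two_ne_zero
  have hf : Differentiable ℝ (fderiv ℝ (uncurry y)) :=
    (hy.fderiv_right (m := 1) (by norm_num)).differentiable one_ne_zero
  have h12 : (1 : WithTop ℕ∞) + 1 ≤ 2 := by norm_num
  funext x t
  have e1 := congrFun (uncurry_pdt_eq_fderiv ((hy.uncurry_pdx h12).differentiable one_ne_zero)) (x, t)
  have e2 := congrFun (uncurry_pdx_eq_fderiv ((hy.uncurry_pdt h12).differentiable one_ne_zero)) (x, t)
  rw [uncurry_pdx_eq_fderiv hd, fderiv_clm_apply (hf _) (differentiableAt_const _)] at e1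
  rw [uncurry_pdt_eq_fderiv hd, fderiv_clm_apply (hf _) (differentiableAt_const _)] at e2
  have hs := (hy.contDiffAt (x := (x, t))).isSymmSndFDerivAt (by simp)
  simp only [uncurry_apply_pair] at e1 e2
  rw [e1, e2]
  simpa using hs (0, 1) (1, 0)

end PartialDerivatives

/-- A differentiable function vanishing on `[0, ∞)` has zero derivative there. -/
theorem HasDerivAt.eq_zero_of_eq_zero_on_nonneg {f : ℝ → ℝ} {f' t : ℝ} (hf : HasDerivAt f f' t)
    (ht : 0 ≤ t) (h : ∀ s, 0 ≤ s → f s = 0) : f' = 0 :=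
  ((uniqueDiffOn_Ici (0 : ℝ)) t ht).eq_deriv _ hf.hasDerivWithinAt
    ((hasDerivWithinAt_const t _ (0 : ℝ)).congr h (h t ht))

/-- Pointwise dissipation estimate for the quadratic-quartic form arising in `V′`. -/
theorem dissipation_le {b δ η v : ℝ} (hb : 0 < b) (hδ : 0 < δ) (hη : 0 < η)
    (hv0 : 0 ≤ v) (hv1 : v < 1) (p q r : ℝ) :
    δ * (-p ^ 2 + 2 * v * p * q - (1 - v ^ 2) * q ^ 2 - b / 2 * q ^ 4) - η * q ^ 2 * r ^ 2
      ≤ -(2 * δ * (1 - v - v ^ 2) / (1 - v ^ 2)) *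
        ((1/2) * p ^ 2 + (1/2) * (1 - v ^ 2) * q ^ 2 + (b/8) * q ^ 4) := by
  have ha : 0 < 1 - v ^ 2 := by nlinarith
  obtain ⟨k, hk⟩ : ∃ k, k = v / (1 - v ^ 2) := ⟨_, rfl⟩
  have hka : k * (1 - v ^ 2) = v := by rw [hk]; field_simp
  have hK : 2 * δ * (1 - v - v ^ 2) / (1 - v ^ 2) = 2 * δ * (1 - k) := by
    rw [hk]; field_simp; ring
  have hk0 : 0 ≤ k := hk ▸ div_nonneg hv0 ha.le
  have hkv : 0 ≤ k - v := by nlinarith [mul_nonneg hk0 (sq_nonneg v)]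
  have key : 0 ≤ δ * (v * (p - q) ^ 2 + (k - v) * p ^ 2 + b / 4 * (1 + k) * q ^ 4)
      + η * (q * r) ^ 2 := by positivity
  rw [hK]
  linear_combination key - δ * q ^ 2 * hka


/-- Along C³ solutions of the Kelvin–Voigt moving-string PDE, the Lyapunov
function `V` is differentiable and `V′(t) ≤ −2δ(1 − v − v²)/(1 − v²) · E(t)`. -/
theorem stmt_12 (b δ η v : ℝ) (hb : 0 < b) (hδ : 0 < δ) (hη : 0 < η)
    (hv0 : 0 ≤ v) (hv1 : v < 1)
    (y : ℝ → ℝ → ℝ)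
    (hy : ContDiff ℝ 3 (Function.uncurry y))
    (hpde : ∀ x ∈ Set.Ioo (0:ℝ) 1, ∀ t : ℝ, 0 ≤ t →
      pdt (pdt y) x t + 2 * δ * pdt y x t + 2 * v * pdx (pdt y) x t
        = (1 - v ^ 2 + (3/2) * b * (pdx y x t) ^ 2) * pdx (pdx y) x t
          + 2 * η * pdx y x t * pdx (pdx y) x t * pdx (pdt y) x t
          + η * (pdx y x t) ^ 2 * pdx (pdx (pdt y)) x t)
    (hbc : ∀ t : ℝ, 0 ≤ t → y 0 t = 0 ∧ y 1 t = 0)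
    (E V : ℝ → ℝ)
    (hE : ∀ t : ℝ, E t = ∫ x in (0:ℝ)..1,
      ((1/2) * (pdt y x t) ^ 2 + (1/2) * (1 - v ^ 2) * (pdx y x t) ^ 2
        + (b/8) * (pdx y x t) ^ 4))
    (hV : ∀ t : ℝ, V t = E t + δ * ∫ x in (0:ℝ)..1,
      (y x t * pdt y x t + δ * (y x t) ^ 2 + (η/4) * (pdx y x t) ^ 4)) :
    ∀ t : ℝ, 0 ≤ t → DifferentiableAt ℝ V t ∧
      deriv V t ≤ -(2 * δ * (1 - v - v ^ 2) / (1 - v ^ 2)) * E t := by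
  intro t ht
  have hy2 : ContDiff ℝ 2 (Function.uncurry y) := hy.of_le (by norm_num)
  have hp : ContDiff ℝ 2 (Function.uncurry (pdt y)) := hy.uncurry_pdt (by norm_num)
  have hq : ContDiff ℝ 2 (Function.uncurry (pdx y)) := hy.uncurry_pdx (by norm_num)
  have hr : ContDiff ℝ 1 (Function.uncurry (pdx (pdt y))) := hp.uncurry_pdx (by norm_num)
  have hs : ContDiff ℝ 1 (Function.uncurry (pdt (pdt y))) := hp.uncurry_pdt (by norm_num)
  have hw : ContDiff ℝ 1 (Function.uncurry (pdx (pdx y))) := hq.uncurry_pdx (by norm_num)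
  have hz : ContDiff ℝ 0 (Function.uncurry (pdx (pdx (pdt y)))) := hr.uncurry_pdx (by norm_num)
  have yt := hasDerivAt_pdt (hy.differentiable three_ne_zero)
  have yx := hasDerivAt_pdx (hy.differentiable three_ne_zero)
  have pt := hasDerivAt_pdt (hp.differentiable two_ne_zero)
  have px := hasDerivAt_pdx (hp.differentiable two_ne_zero)
  have qt := hasDerivAt_pdt (hq.differentiable two_ne_zero)
  rw [pdt_pdx_eq_pdx_pdt hy2] at qt
  have qx := hasDerivAt_pdx (hq.differentiable two_ne_zero)
  have rx := hasDerivAt_pdx (hr.differentiable one_ne_zero)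
  have p0 := (yt 0 t).eq_zero_of_eq_zero_on_nonneg ht fun s hs => (hbc s hs).1
  have p1 := (yt 1 t).eq_zero_of_eq_zero_on_nonneg ht fun s hs => (hbc s hs).2
  obtain ⟨y0, y1⟩ := hbc t ht
  have cy := hy.continuous
  have cp := hp.continuous
  have cq := hq.continuous
  have cr := hr.continuous
  have cs := hs.continuous
  have cw := hw.continuous
  have cz := hz.continuous
  generalize pdx (pdx (pdt y)) = z at *
  generalize pdx (pdx y) = w at *
  generalize pdt (pdt y) = s at *
  generalize pdx (pdt y) = r at *
  generalize pdt y = p at *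
  generalize pdx y = q at *
  have hslice {f : ℝ → ℝ → ℝ} (hf : Continuous (Function.uncurry f)) :
      Continuous fun x => f x t :=
    hf.comp (continuous_id.prodMk continuous_const)
  have dE : HasDerivAt E (∫ x in (0:ℝ)..1, (p x t * s x t + (1 - v ^ 2) * q x t * r x t
      + b / 2 * q x t ^ 3 * r x t)) t := by
    rw [funext hE]
    refine hasDerivAt_intervalIntegral_of_continuous
      (F := fun x t => (1/2) * p x t ^ 2 + (1/2) * (1 - v ^ 2) * q x t ^ 2 + (b/8) * q x t ^ 4)
      (F' := fun x t => p x t * s x t + (1 - v ^ 2) * q x t * r x t + b / 2 * q x t ^ 3 * r x t)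
      0 1 ?_ ?_ (fun x t => ?_) t
    · simp only [Function.uncurry_def] at *; fun_prop
    · simp only [Function.uncurry_def] at *; fun_prop
    · exact ((((pt x t).pow 2).const_mul (1/2)).add
        (((qt x t).pow 2).const_mul ((1/2) * (1 - v ^ 2))) |>.add
        (((qt x t).pow 4).const_mul (b/8))).congr_deriv (by push_cast; ring)
  have dW : HasDerivAt (fun t => ∫ x in (0:ℝ)..1,
      (y x t * p x t + δ * (y x t) ^ 2 + (η/4) * (q x t) ^ 4))
      (∫ x in (0:ℝ)..1, (p x t ^ 2 + y x t * s x t + 2 * δ * y x t * p x t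
        + η * q x t ^ 3 * r x t)) t := by
    refine hasDerivAt_intervalIntegral_of_continuous
      (F := fun x t => y x t * p x t + δ * (y x t) ^ 2 + (η/4) * (q x t) ^ 4)
      (F' := fun x t => p x t ^ 2 + y x t * s x t + 2 * δ * y x t * p x t
        + η * q x t ^ 3 * r x t)
      0 1 ?_ ?_ (fun x t => ?_) t
    · simp only [Function.uncurry_def] at *; fun_prop
    · simp only [Function.uncurry_def] at *; fun_prop
    · exact (((yt x t).mul (pt x t)).add (((yt x t).pow 2).const_mul δ) |>.add
        (((qt x t).pow 4).const_mul (η/4))).congr_deriv (by push_cast; ring)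
  have dV := (dE.add (dW.const_mul δ)).congr_of_eventuallyEq (.of_forall hV)
  refine ⟨dV.differentiableAt, ?_⟩
  rw [dV.deriv]
  have ky := hslice cy
  have kp := hslice cp
  have kq := hslice cq
  have kr := hslice cr
  have ks := hslice cs
  have kw := hslice cw
  have kz := hslice cz
  have dS (x : ℝ) := (((qx x t).const_mul (1 - v ^ 2)).add
    (((qx x t).pow 3).const_mul (b / 2))).add ((((qx x t).pow 2).mul (rx x t)).const_mul η)
  have dG (x : ℝ) : HasDerivAt
      (fun x => (p x t + δ * y x t) * ((1 - v ^ 2) * q x t + b / 2 * q x t ^ 3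
        + η * (q x t ^ 2 * r x t)) - v * p x t ^ 2 - 2 * v * δ * (y x t * p x t))
      ((r x t + δ * q x t) * ((1 - v ^ 2) * q x t + b / 2 * q x t ^ 3 + η * (q x t ^ 2 * r x t))
        + (p x t + δ * y x t) * ((1 - v ^ 2 + 3 / 2 * b * q x t ^ 2) * w x t
          + 2 * η * q x t * w x t * r x t + η * q x t ^ 2 * z x t)
        - 2 * v * p x t * r x t - 2 * v * δ * (q x t * p x t + y x t * r x t)) x := by
    refine (((((px x t).add ((yx x t).const_mul δ)).mul (dS x)).sub
      (((px x t).pow 2).const_mul v)).sub (((yx x t).mul (px x t)).const_mul (2 * v * δ))).congr_deriv ?_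
    simp only [Pi.add_apply, Pi.mul_apply, Pi.pow_apply]
    push_cast; ring
  have hG := (intervalIntegral.integral_eq_sub_of_hasDerivAt (a := 0) (b := 1)
    (fun x _ => dG x) (Continuous.intervalIntegrable (by fun_prop) _ _)).trans
    (show _ = (0:ℝ) by simp [p0, p1, y0, y1])
  rw [hE, ← intervalIntegral.integral_const_mul, ← intervalIntegral.integral_const_mul,
    ← intervalIntegral.integral_add (Continuous.intervalIntegrable (by fun_prop) _ _)
      (Continuous.intervalIntegrable (by fun_prop) _ _)]
  refine (sub_zero _).symm.trans_le ((congrArg (_ - ·) hG.symm).trans_le ?_)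
  rw [← intervalIntegral.integral_sub (Continuous.intervalIntegrable (by fun_prop) _ _)
      (Continuous.intervalIntegrable (by fun_prop) _ _)]
  refine intervalIntegral.integral_mono_on_of_le_Ioo zero_le_one
    (Continuous.intervalIntegrable (by fun_prop) _ _)
    (Continuous.intervalIntegrable (by fun_prop) _ _) fun x hx => ?_
  linear_combination dissipation_le hb hδ hη hv0 hv1 (p x t) (q x t) (r x t)
    + (p x t + δ * y x t) * hpde x hx t ht
end

section
/- Let b > 0, δ > 0, η > 0 be real constants, let v satisfy 0 ≤ v < (√5 − 1)/2, set K = 1 + δ · max{ (1 + 2δ/π)/(π(1 − v²)), 2η/b }, and let ε be any real number with 0 < ε < 2δ(1 − v − v²)/(K(1 − v²)). Let F : (0,1) × [0,∞) → ℝ be a measurable forcing function with ‖F‖_{X∞} := sup_{t ≥ 0} sup_{x ∈ (0,1)} |F(x,t)| < ∞, and let y : [0,1] × [0,∞) → ℝ be a sufficiently smooth (of class C³) solution of the forced PDE y_tt + 2δ y_t + 2v y_xt = (1 − v² + (3/2) b y_x²) y_xx + 2η y_x y_xx y_xt + η y_x² y_xxt + F(x,t) on (0,1) × [0,∞), with boundary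 conditions y(0,t) = y(1,t) = 0 for all t ≥ 0 and zero initial conditions y(x,0) = 0, y_t(x,0) = 0 for all x ∈ (0,1). Then the displacement is bounded and satisfies sup_{t ≥ 0} sup_{x ∈ (0,1)} |y(x,t)| ≤ √( K / ( ε [ (2δ − εK)(1 − v²) − 2δv ] ) ) · sup_{t ≥ 0} ( ∫₀¹ F(x,t)² dx )^{1/2} < ∞. -/
open Real

section

open Set Filter Topology MeasureTheory intervalIntegral

lemma continuousAt_sq_mul_cot {f : ℝ → ℝ} {f' a : ℝ} (hf : HasDerivAt f f' a) (hfa : f a = 0)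
    (hs : sin (π * a) = 0) (hc : cos (π * a) ≠ 0) :
    ContinuousAt (fun x => f x ^ 2 * (π * cos (π * x) / sin (π * x))) a := by
  have hsin : HasDerivAt (fun x => sin (π * x)) (cos (π * a) * π) a := by
    simpa using (hasDerivAt_id a).const_mul π |>.sin
  have hne : cos (π * a) * π ≠ 0 := mul_ne_zero hc pi_ne_zero
  have hq := (hasDerivAt_iff_tendsto_slope.1 hf).div (hasDerivAt_iff_tendsto_slope.1 hsin) hne
  have hfc : Tendsto f (𝓝[≠] a) (𝓝 0) := by
    simpa [hfa] using hf.continuousAt.tendsto.mono_left nhdsWithin_le_nhds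
  have hcos : Tendsto (fun x => π * cos (π * x)) (𝓝[≠] a) (𝓝 (π * cos (π * a))) :=
    ((by fun_prop : Continuous fun x => π * cos (π * x)).tendsto a).mono_left nhdsWithin_le_nhds
  rw [← continuousWithinAt_compl_self]
  have key := (hfc.mul hcos).mul hq
  simp only [zero_mul] at key
  unfold ContinuousWithinAt
  simp only [hfa, ne_eq, OfNat.ofNat_ne_zero, not_false_eq_true, zero_pow, zero_mul]
  refine key.congr' ?_
  filter_upwards [self_mem_nhdsWithin] with x hx
  have hxa : x - a ≠ 0 := sub_ne_zero.2 hx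
  simp only [Pi.div_apply, slope_def_field, hfa, hs, sub_zero]
  rw [div_div_div_cancel_right₀ hxa]
  ring

/-- Wirtinger's inequality on the unit interval with Dirichlet boundary conditions. -/
lemma wirtinger_dirichlet {f f' : ℝ → ℝ} (hf : ∀ x, HasDerivAt f (f' x) x) (hf' : Continuous f')
    (h0 : f 0 = 0) (h1 : f 1 = 0) :
    0 ≤ ∫ x in (0:ℝ)..1, (f' x ^ 2 - π ^ 2 * f x ^ 2) := by
  have hfc : Continuous f := continuous_iff_continuousAt.2 fun x => (hf x).continuousAt
  have hcont : Continuous fun x => f' x ^ 2 - π ^ 2 * f x ^ 2 := by fun_prop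
  let G : ℝ → ℝ := fun x =>
    (∫ s in (0:ℝ)..x, (f' s ^ 2 - π ^ 2 * f s ^ 2)) - f x ^ 2 * (π * cos (π * x) / sin (π * x))
  have hsin : ∀ x ∈ Ioo (0:ℝ) 1, 0 < sin (π * x) := fun x hx =>
    sin_pos_of_pos_of_lt_pi (mul_pos pi_pos hx.1) (by nlinarith [pi_pos, hx.2])
  have hd : ∀ x ∈ Ioo (0:ℝ) 1,
      HasDerivAt G ((f' x - f x * (π * cos (π * x) / sin (π * x))) ^ 2) x := by
    intro x hx
    have hs := (hsin x hx).ne'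
    have e1 : HasDerivAt (fun x => sin (π * x)) (cos (π * x) * π) x := by
      simpa using (hasDerivAt_id x).const_mul π |>.sin
    have e2 : HasDerivAt (fun x => π * cos (π * x)) (π * (-sin (π * x) * π)) x := by
      simpa using ((hasDerivAt_id x).const_mul π |>.cos).const_mul π
    have e3 := (hcont.integral_hasStrictDerivAt 0 x).hasDerivAt.sub
      (((hf x).pow 2).mul (e2.div e1 hs))
    refine e3.congr_deriv ?_
    simp only [Pi.pow_apply, Pi.div_apply]
    field_simp
    push_cast
    ring
  have hmono : MonotoneOn G (Icc 0 1) := by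
    refine monotoneOn_of_deriv_nonneg (convex_Icc 0 1) ?_ ?_ ?_
    · intro x hx
      refine ContinuousAt.continuousWithinAt ?_
      rcases eq_or_lt_of_le hx.1 with rfl | hx0
      · exact (hcont.integral_hasStrictDerivAt 0 _).hasDerivAt.continuousAt.sub
          (continuousAt_sq_mul_cot (hf 0) h0 (by simp) (by simp))
      rcases eq_or_lt_of_le hx.2 with rfl | hx1
      · exact (hcont.integral_hasStrictDerivAt 0 _).hasDerivAt.continuousAt.sub
          (continuousAt_sq_mul_cot (hf 1) h1 (by simp) (by simp))
      exact (hd x ⟨hx0, hx1⟩).continuousAt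
    · rw [interior_Icc]
      exact fun x hx => (hd x hx).differentiableAt.differentiableWithinAt
    · rw [interior_Icc]
      exact fun x hx => (hd x hx).deriv ▸ sq_nonneg _
  simpa [G, h0, h1] using
    hmono (left_mem_Icc.2 zero_le_one) (right_mem_Icc.2 zero_le_one) zero_le_one

/-- A one-dimensional Sobolev bound for functions vanishing at the left end point. -/
lemma sq_le_integral_deriv_sq {f f' : ℝ → ℝ} (hf : ∀ x, HasDerivAt f (f' x) x)
    (hf' : Continuous f') (h0 : f 0 = 0) {x : ℝ} (hx : x ∈ Ioo (0:ℝ) 1) :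
    f x ^ 2 ≤ ∫ s in (0:ℝ)..1, f' s ^ 2 := by
  have hftc : ∫ s in (0:ℝ)..x, f' s = f x := by
    rw [integral_eq_sub_of_hasDerivAt (fun s _ => hf s) (hf'.intervalIntegrable _ _), h0, sub_zero]
  have hnn : 0 ≤ ∫ s in (0:ℝ)..x, (f' s - f x) ^ 2 :=
    integral_nonneg hx.1.le fun _ _ => sq_nonneg _
  have hexp : ∫ s in (0:ℝ)..x, (f' s - f x) ^ 2 =
      (∫ s in (0:ℝ)..x, f' s ^ 2) - 2 * f x * f x + x * f x ^ 2 := by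
    have : ∀ s, (f' s - f x) ^ 2 = f' s ^ 2 - 2 * f x * f' s + f x ^ 2 := fun s => by ring
    simp only [this]
    rw [integral_add (Continuous.intervalIntegrable (by fun_prop) _ _)
      (Continuous.intervalIntegrable (by fun_prop) _ _),
      integral_sub (Continuous.intervalIntegrable (by fun_prop) _ _)
      (Continuous.intervalIntegrable (by fun_prop) _ _), intervalIntegral.integral_const_mul, hftc]
    simp
  have hsplit : (∫ s in (0:ℝ)..x, f' s ^ 2) + ∫ s in x..1, f' s ^ 2 = ∫ s in (0:ℝ)..1, f' s ^ 2 :=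
    integral_add_adjacent_intervals (Continuous.intervalIntegrable (by fun_prop) _ _)
      (Continuous.intervalIntegrable (by fun_prop) _ _)
  have hrest : 0 ≤ ∫ s in x..1, f' s ^ 2 := integral_nonneg hx.2.le fun _ _ => sq_nonneg _
  nlinarith [hx.2, sq_nonneg (f x)]

lemma hasDerivAt_integral_of_continuous {h h' : ℝ → ℝ → ℝ} (hh : Continuous (Function.uncurry h))
    (hh' : Continuous (Function.uncurry h'))
    (hd : ∀ x t, HasDerivAt (fun t => h x t) (h' x t) t) (t : ℝ) :
    HasDerivAt (fun t => ∫ x in (0:ℝ)..1, h x t) (∫ x in (0:ℝ)..1, h' x t) t := by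
  have hc : ∀ s, Continuous fun x => h x s :=
    fun s => hh.comp (by fun_prop : Continuous fun x => (x, s))
  have hc' : ∀ s, Continuous fun x => h' x s :=
    fun s => hh'.comp (by fun_prop : Continuous fun x => (x, s))
  obtain ⟨C, hC⟩ := (isCompact_Icc.prod isCompact_Icc : IsCompact
    (Icc (0:ℝ) 1 ×ˢ Icc (t - 1) (t + 1))).exists_bound_of_continuousOn hh'.continuousOn
  refine (hasDerivAt_integral_of_dominated_loc_of_deriv_le (F := fun t x => h x t)
    (F' := fun t x => h' x t) (bound := fun _ => C)
    (Icc_mem_nhds (by linarith : t - 1 < t) (by linarith : t < t + 1))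
    (.of_forall fun s => (hc s).aestronglyMeasurable) ((hc t).intervalIntegrable _ _)
    (hc' t).aestronglyMeasurable (.of_forall fun x hx s hs => ?_) intervalIntegrable_const
    (.of_forall fun x _ s _ => hd x s)).2
  rw [uIoc_of_le zero_le_one] at hx
  exact hC (x, s) ⟨⟨hx.1.le, hx.2⟩, hs⟩

/-- Grönwall's inequality for `V' ≤ -ε V + C` starting from `V 0 = 0`. -/
lemma le_div_of_deriv_le {V V' : ℝ → ℝ} {ε C : ℝ} (hε : 0 < ε) (hC : 0 ≤ C)
    (hV : ∀ t, HasDerivAt V (V' t) t) (h0 : V 0 = 0) (hV' : ∀ t, 0 < t → V' t ≤ -ε * V t + C)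
    {t : ℝ} (ht : 0 ≤ t) : V t ≤ C / ε := by
  let W : ℝ → ℝ := fun t => rexp (ε * t) * (V t - C / ε)
  have hW : ∀ t, HasDerivAt W (rexp (ε * t) * (ε * V t - C + V' t)) t := by
    intro t
    have e1 : HasDerivAt (fun t => rexp (ε * t)) (rexp (ε * t) * ε) t := by
      simpa using (hasDerivAt_id t).const_mul ε |>.exp
    refine (e1.mul ((hV t).sub_const (C / ε))).congr_deriv ?_
    field_simp
  have hanti : AntitoneOn W (Ici 0) := by
    refine antitoneOn_of_deriv_nonpos (convex_Ici 0)
      (fun t _ => (hW t).continuousAt.continuousWithinAt)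
      (fun t _ => (hW t).differentiableAt.differentiableWithinAt) fun t ht => ?_
    rw [interior_Ici] at ht
    rw [(hW t).deriv]
    exact mul_nonpos_of_nonneg_of_nonpos (exp_pos _).le (by linarith [hV' t ht])
  have hle : W t ≤ W 0 := hanti self_mem_Ici ht ht
  have hW0 : W 0 ≤ 0 := by simpa [W, h0] using div_nonneg hC hε.le
  by_contra! hlt
  exact absurd (hle.trans hW0) (not_le.2 (mul_pos (exp_pos _) (sub_pos.2 hlt)))

lemma hasDerivAt_pdx_s16 {u : ℝ → ℝ → ℝ} (hu : ContDiff ℝ 1 (Function.uncurry u)) (x t : ℝ) :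
    HasDerivAt (fun x => u x t) (pdx u x t) x :=
  (((hu.differentiable one_ne_zero).comp
    (by fun_prop : Differentiable ℝ fun x : ℝ => (x, t))) x).hasDerivAt

lemma hasDerivAt_pdt_s16 {u : ℝ → ℝ → ℝ} (hu : ContDiff ℝ 1 (Function.uncurry u)) (x t : ℝ) :
    HasDerivAt (fun t => u x t) (pdt u x t) t :=
  (((hu.differentiable one_ne_zero).comp
    (by fun_prop : Differentiable ℝ fun t : ℝ => (x, t))) t).hasDerivAt

lemma pdx_eq_fderiv {u : ℝ → ℝ → ℝ} (hu : ContDiff ℝ 1 (Function.uncurry u)) (x t : ℝ) :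
    pdx u x t = fderiv ℝ (Function.uncurry u) (x, t) (1, 0) :=
  ((hu.differentiable one_ne_zero (x, t)).hasFDerivAt.comp_hasDerivAt (f := fun x => (x, t)) x
    ((hasDerivAt_id x).prodMk (hasDerivAt_const x t))).deriv

lemma pdt_eq_fderiv {u : ℝ → ℝ → ℝ} (hu : ContDiff ℝ 1 (Function.uncurry u)) (x t : ℝ) :
    pdt u x t = fderiv ℝ (Function.uncurry u) (x, t) (0, 1) :=
  ((hu.differentiable one_ne_zero (x, t)).hasFDerivAt.comp_hasDerivAt (f := fun t => (x, t)) t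
    ((hasDerivAt_const t x).prodMk (hasDerivAt_id t))).deriv

lemma contDiff_pdx {u : ℝ → ℝ → ℝ} {n : ℕ} (hu : ContDiff ℝ (n + 1) (Function.uncurry u)) :
    ContDiff ℝ n (Function.uncurry (pdx u)) := by
  have : Function.uncurry (pdx u) = fun p => fderiv ℝ (Function.uncurry u) p (1, 0) :=
    funext fun p => pdx_eq_fderiv (hu.of_le (by simp)) p.1 p.2
  rw [this]
  exact (hu.fderiv_right le_rfl).clm_apply contDiff_const

lemma contDiff_pdt {u : ℝ → ℝ → ℝ} {n : ℕ} (hu : ContDiff ℝ (n + 1) (Function.uncurry u)) :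
    ContDiff ℝ n (Function.uncurry (pdt u)) := by
  have : Function.uncurry (pdt u) = fun p => fderiv ℝ (Function.uncurry u) p (0, 1) :=
    funext fun p => pdt_eq_fderiv (hu.of_le (by simp)) p.1 p.2
  rw [this]
  exact (hu.fderiv_right le_rfl).clm_apply contDiff_const

lemma pdt_pdx_comm {u : ℝ → ℝ → ℝ} (hu : ContDiff ℝ 2 (Function.uncurry u)) (x t : ℝ) :
    pdt (pdx u) x t = pdx (pdt u) x t := by
  have hu1 : ContDiff ℝ 1 (Function.uncurry u) := hu.of_le one_le_two
  have hu' : ContDiff ℝ ((1 : ℕ) + 1) (Function.uncurry u) := by simpa [one_add_one_eq_two] using hu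
  have ex : Function.uncurry (pdx u) = fun p => fderiv ℝ (Function.uncurry u) p (1, 0) :=
    funext fun p => pdx_eq_fderiv hu1 p.1 p.2
  have et : Function.uncurry (pdt u) = fun p => fderiv ℝ (Function.uncurry u) p (0, 1) :=
    funext fun p => pdt_eq_fderiv hu1 p.1 p.2
  have hdd : DifferentiableAt ℝ (fderiv ℝ (Function.uncurry u)) (x, t) :=
    ((hu'.fderiv_right le_rfl).differentiable (by simp)) _
  rw [pdt_eq_fderiv (by simpa using contDiff_pdx hu'),
    pdx_eq_fderiv (by simpa using contDiff_pdt hu'),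
    ex, et, fderiv_clm_apply hdd (by fun_prop), fderiv_clm_apply hdd (by fun_prop)]
  simpa using (hu.contDiffAt.isSymmSndFDerivAt (by simp) : IsSymmSndFDerivAt ℝ _ (x, t)) (0, 1) (1, 0)

/-- Density of the Lyapunov functional, in terms of the values `p = y`, `q = y_t`, `r = y_x`. -/
noncomputable def lyapunovDensity (b δ η v p q r : ℝ) : ℝ :=
  q ^ 2 / 2 + (1 - v ^ 2) / 2 * r ^ 2 + b / 8 * r ^ 4 +
    δ * (p * q + δ * p ^ 2 + η / 4 * r ^ 4)

lemma sq_le_two_mul_lyapunovDensity {b δ η v : ℝ} (hb : 0 < b) (hδ : 0 < δ) (hη : 0 < η)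
    (ha : 0 < 1 - v ^ 2) (p q r : ℝ) : (q + δ * p) ^ 2 ≤ 2 * lyapunovDensity b δ η v p q r := by
  have h1 : 0 ≤ (1 - v ^ 2) * r ^ 2 := by positivity
  have h2 : 0 ≤ b * r ^ 4 := by positivity
  have h3 : 0 ≤ δ * η * r ^ 4 := by positivity
  have h4 : 0 ≤ (δ * p) ^ 2 := by positivity
  unfold lyapunovDensity
  nlinarith

lemma mul_sq_le_lyapunovDensity {b δ η v : ℝ} (hb : 0 < b) (hδ : 0 < δ) (hη : 0 < η)
    (p q r : ℝ) : (1 - v ^ 2) / 2 * r ^ 2 ≤ lyapunovDensity b δ η v p q r := by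
  have h2 : 0 ≤ b * r ^ 4 := by positivity
  have h3 : 0 ≤ δ * η * r ^ 4 := by positivity
  have h4 : 0 ≤ (δ * p) ^ 2 := by positivity
  unfold lyapunovDensity
  nlinarith [sq_nonneg (q + δ * p)]

/-- The Lyapunov density is dominated by `K` times the energy density, up to a Wirtinger term. -/
lemma lyapunovDensity_le {b δ η v K : ℝ} (hδ : 0 < δ) (hK1 : δ / π ≤ K - 1)
    (hK2 : δ / (2 * π) + δ ^ 2 / π ^ 2 ≤ (K - 1) * (1 - v ^ 2) / 2)
    (hK3 : 2 * δ * η ≤ (K - 1) * b) (p q r : ℝ) :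
    lyapunovDensity b δ η v p q r ≤
      K * (q ^ 2 / 2 + (1 - v ^ 2) / 2 * r ^ 2 + b / 8 * r ^ 4) +
        (δ / (2 * π) + δ ^ 2 / π ^ 2) * (π ^ 2 * p ^ 2 - r ^ 2) := by
  have hpq : δ * (p * q) ≤ δ / π * q ^ 2 / 2 + δ * π / 2 * p ^ 2 := by
    have e : δ / π * q ^ 2 / 2 + δ * π / 2 * p ^ 2 - δ * (p * q) =
        δ / (2 * π) * (q - π * p) ^ 2 := by
      field_simp
      ring
    have : 0 ≤ δ / (2 * π) * (q - π * p) ^ 2 := by positivity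
    linarith
  have hc : (δ / (2 * π) + δ ^ 2 / π ^ 2) * (π ^ 2 * p ^ 2) = δ * π / 2 * p ^ 2 + δ ^ 2 * p ^ 2 := by
    field_simp
  have h1 := mul_le_mul_of_nonneg_right hK1 (sq_nonneg q)
  have h2 := mul_le_mul_of_nonneg_right hK2 (sq_nonneg r)
  have h3 := mul_le_mul_of_nonneg_right hK3 (by positivity : 0 ≤ r ^ 4)
  unfold lyapunovDensity
  linarith

/-- Pointwise dissipation estimate for the Lyapunov density. -/
lemma dissipation_le_s16 {b δ η v K ε l : ℝ} (hb : 0 < b) (hδ : 0 < δ) (hη : 0 < η) (hv : 0 ≤ v)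
    (ha : 0 < 1 - v ^ 2) (hε : 0 < ε) (hl : 0 < l)
    (hρ : (ε + l) * K * (1 - v ^ 2) = 2 * δ * (1 - v - v ^ 2)) (hK1 : δ / π ≤ K - 1)
    (hK2 : δ / (2 * π) + δ ^ 2 / π ^ 2 ≤ (K - 1) * (1 - v ^ 2) / 2)
    (hK3 : 2 * δ * η ≤ (K - 1) * b) (p q r s f : ℝ) :
    -δ * q ^ 2 + 2 * v * δ * r * q - δ * (1 - v ^ 2) * r ^ 2 - δ * b / 2 * r ^ 4 -
        η * r ^ 2 * s ^ 2 + f * (q + δ * p) ≤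
      -ε * lyapunovDensity b δ η v p q r +
        (ε + l) * (δ / (2 * π) + δ ^ 2 / π ^ 2) * (π ^ 2 * p ^ 2 - r ^ 2) + f ^ 2 / (2 * l) := by
  have hforce : f * (q + δ * p) ≤ l * lyapunovDensity b δ η v p q r + f ^ 2 / (2 * l) := by
    have e : l / 2 * (q + δ * p) ^ 2 + f ^ 2 / (2 * l) - f * (q + δ * p) =
        (l * (q + δ * p) - f) ^ 2 / (2 * l) := by
      field_simp
      ring
    have : 0 ≤ (l * (q + δ * p) - f) ^ 2 / (2 * l) := by positivity
    have := mul_le_mul_of_nonneg_left (sq_le_two_mul_lyapunovDensity hb hδ hη ha p q r) hl.le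
    linarith
  have hlyap := mul_le_mul_of_nonneg_left (lyapunovDensity_le hδ hK1 hK2 hK3 p q r)
    (add_pos hε hl).le
  have hρ1 : (ε + l) * K ≤ 2 * δ * (1 - v) := by
    refine le_of_mul_le_mul_right ?_ ha
    have : 0 ≤ δ * v ^ 3 := by positivity
    nlinarith
  have hρ2 : (ε + l) * K ≤ 4 * δ := by nlinarith
  have h1 := mul_le_mul_of_nonneg_right hρ1 (sq_nonneg q)
  have h2 := mul_le_mul_of_nonneg_right hρ2 (by positivity : 0 ≤ b * r ^ 4)
  have h3 : 0 ≤ v * δ * (r - q) ^ 2 := by positivity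
  have h4 : 0 ≤ η * r ^ 2 * s ^ 2 := by positivity
  have h5 := congrArg (· * r ^ 2) hρ
  nlinarith

lemma K_bounds {b δ η v K : ℝ} (hb : 0 < b) (hδ : 0 < δ) (ha : 0 < 1 - v ^ 2)
    (hK : K = 1 + δ * max ((1 + 2 * δ / π) / (π * (1 - v ^ 2))) (2 * η / b)) :
    δ / π ≤ K - 1 ∧ δ / (2 * π) + δ ^ 2 / π ^ 2 ≤ (K - 1) * (1 - v ^ 2) / 2 ∧
      2 * δ * η ≤ (K - 1) * b := by
  have h1 : δ * ((1 + 2 * δ / π) / (π * (1 - v ^ 2))) ≤ K - 1 := by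
    rw [hK, add_sub_cancel_left]
    exact mul_le_mul_of_nonneg_left (le_max_left _ _) hδ.le
  have h2 : δ * (2 * η / b) ≤ K - 1 := by
    rw [hK, add_sub_cancel_left]
    exact mul_le_mul_of_nonneg_left (le_max_right _ _) hδ.le
  have h3 : δ / (2 * π) + δ ^ 2 / π ^ 2 =
      δ * ((1 + 2 * δ / π) / (π * (1 - v ^ 2))) * (1 - v ^ 2) / 2 := by
    field_simp
  refine ⟨le_trans ?_ h1, ?_, ?_⟩
  · rw [div_eq_mul_one_div]
    refine mul_le_mul_of_nonneg_left (div_le_div₀ (by positivity) ?_ (by positivity) ?_) hδ.le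
    · linarith [show 0 ≤ 2 * δ / π by positivity]
    · nlinarith [pi_pos, sq_nonneg v]
  · rw [h3]
    gcongr
  · calc 2 * δ * η = δ * (2 * η / b) * b := by field_simp
      _ ≤ _ := by gcongr

lemma pdt_eq_zero_of_forall {u : ℝ → ℝ → ℝ} {x t : ℝ} (hu : ∀ s, 0 ≤ s → u x s = 0) (ht : 0 < t) :
    pdt u x t = 0 := by
  have : (fun s => u x s) =ᶠ[𝓝 t] fun _ => 0 := by
    filter_upwards [lt_mem_nhds ht] with s hs using hu s hs.le
  simp [pdt, this.deriv_eq]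

lemma pdx_eq_zero_of_forall {u : ℝ → ℝ → ℝ} {x t : ℝ} (hu : ∀ s ∈ Ioo (0:ℝ) 1, u s t = 0)
    (hx : x ∈ Ioo (0:ℝ) 1) : pdx u x t = 0 := by
  have : (fun s => u s t) =ᶠ[𝓝 x] fun _ => 0 := by
    filter_upwards [Ioo_mem_nhds hx.1 hx.2] with s hs using hu s hs
  simp [pdx, this.deriv_eq]

/-- The `L²` norms of the time slices of a bounded measurable force are bounded by their
supremum. -/
lemma intervalIntegrable_sq_and_le_sSup_sq {F : ℝ → ℝ → ℝ}
    (hFmeas : Measurable (Function.uncurry F)) {M : ℝ}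
    (hM : ∀ t : ℝ, 0 ≤ t → ∀ x ∈ Ioo (0:ℝ) 1, |F x t| ≤ M) {t : ℝ} (ht : 0 ≤ t) :
    IntervalIntegrable (fun x => F x t ^ 2) volume 0 1 ∧
      ∫ x in (0:ℝ)..1, F x t ^ 2 ≤
        sSup {r : ℝ | ∃ s : ℝ, 0 ≤ s ∧ r = √(∫ x in (0:ℝ)..1, F x s ^ 2)} ^ 2 := by
  have hle : ∀ s, 0 ≤ s → ∀ x ∈ Ioo (0:ℝ) 1, F x s ^ 2 ≤ M ^ 2 := fun s hs x hx =>
    sq_le_sq.2 ((hM s hs x hx).trans (le_abs_self M))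
  have hint : ∀ s, 0 ≤ s → IntervalIntegrable (fun x => F x s ^ 2) volume 0 1 := by
    intro s hs
    rw [intervalIntegrable_iff_integrableOn_Ioo_of_le zero_le_one]
    refine Measure.integrableOn_of_bounded (M := M ^ 2) (by simp) ?_ ?_
    · exact ((hFmeas.comp (measurable_id.prodMk measurable_const)).pow_const 2).aestronglyMeasurable
    · refine (ae_restrict_iff' measurableSet_Ioo).2 (.of_forall fun x hx => ?_)
      rw [norm_of_nonneg (sq_nonneg _)]
      exact hle s hs x hx
  have hbdd : BddAbove {r : ℝ | ∃ s : ℝ, 0 ≤ s ∧ r = √(∫ x in (0:ℝ)..1, F x s ^ 2)} := by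
    refine ⟨√(M ^ 2), ?_⟩
    rintro _ ⟨s, hs, rfl⟩
    refine sqrt_le_sqrt ?_
    simpa using integral_mono_on_of_le_Ioo zero_le_one (hint s hs)
      (intervalIntegrable_const (c := M ^ 2)) (hle s hs)
  refine ⟨hint t ht, ?_⟩
  exact (sqrt_le_left ((sqrt_nonneg _).trans (le_csSup hbdd ⟨t, ht, rfl⟩))).1
    (le_csSup hbdd ⟨t, ht, rfl⟩)

/-- Exponential dissipation of the Lyapunov functional along a solution of the forced string
equation, with a remainder controlled by the force. -/
lemma integral_pdt_lyapunovDensity_le {b δ η v K ε l : ℝ} (hb : 0 < b) (hδ : 0 < δ) (hη : 0 < η)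
    (hv : 0 ≤ v) (ha : 0 < 1 - v ^ 2) (hε : 0 < ε) (hl : 0 < l)
    (hρ : (ε + l) * K * (1 - v ^ 2) = 2 * δ * (1 - v - v ^ 2)) (hK1 : δ / π ≤ K - 1)
    (hK2 : δ / (2 * π) + δ ^ 2 / π ^ 2 ≤ (K - 1) * (1 - v ^ 2) / 2)
    (hK3 : 2 * δ * η ≤ (K - 1) * b) {p q q' r r' s s' f h' : ℝ → ℝ}
    (hp : ∀ x, HasDerivAt p (r x) x) (hq : ∀ x, HasDerivAt q (s x) x)
    (hr : ∀ x, HasDerivAt r (r' x) x) (hs : ∀ x, HasDerivAt s (s' x) x)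
    (hq' : Continuous q') (hr' : Continuous r') (hs' : Continuous s')
    (hpde : ∀ x ∈ Ioo (0:ℝ) 1, q' x + 2 * δ * q x + 2 * v * s x =
      (1 - v ^ 2 + (3/2) * b * r x ^ 2) * r' x + 2 * η * r x * r' x * s x +
        η * r x ^ 2 * s' x + f x)
    (hp0 : p 0 = 0) (hp1 : p 1 = 0) (hq0 : q 0 = 0) (hq1 : q 1 = 0)
    (hf : IntervalIntegrable (fun x => f x ^ 2) volume 0 1)
    (hh' : ∀ x, h' x = q x * q' x + (1 - v ^ 2) * r x * s x + b / 2 * r x ^ 3 * s x +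
      δ * (q x * q x + p x * q' x + 2 * δ * p x * q x + η * r x ^ 3 * s x)) :
    ∫ x in (0:ℝ)..1, h' x ≤
      -ε * (∫ x in (0:ℝ)..1, lyapunovDensity b δ η v (p x) (q x) (r x)) +
        (∫ x in (0:ℝ)..1, f x ^ 2) / (2 * l) := by
  have cp : Continuous p := continuous_iff_continuousAt.2 fun x => (hp x).continuousAt
  have cq : Continuous q := continuous_iff_continuousAt.2 fun x => (hq x).continuousAt
  have cr : Continuous r := continuous_iff_continuousAt.2 fun x => (hr x).continuousAt
  have cs : Continuous s := continuous_iff_continuousAt.2 fun x => (hs x).continuousAt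
  let S : ℝ → ℝ := fun x => (1 - v ^ 2) * r x + b / 2 * r x ^ 3 + η * (r x ^ 2 * s x)
  let S' : ℝ → ℝ := fun x => (1 - v ^ 2) * r' x + b / 2 * (3 * r x ^ 2 * r' x) +
    η * (2 * r x * r' x * s x + r x ^ 2 * s' x)
  let P : ℝ → ℝ := fun x => S x * (q x + δ * p x) - v * q x ^ 2 - 2 * v * δ * (p x * q x)
  let P' : ℝ → ℝ := fun x => S' x * (q x + δ * p x) + S x * (s x + δ * r x) -
    v * (2 * q x * s x) - 2 * v * δ * (r x * q x + p x * s x)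
  have cP' : Continuous P' := by
    simp only [P', S, S']
    fun_prop
  have hS : ∀ x, HasDerivAt S (S' x) x := by
    intro x
    refine ((((hr x).const_mul (1 - v ^ 2)).add (((hr x).pow 3).const_mul (b / 2))).add
      ((((hr x).pow 2).mul (hs x)).const_mul η)).congr_deriv ?_
    simp [S']
  have hP : ∀ x, HasDerivAt P (P' x) x := by
    intro x
    refine ((((hS x).mul ((hq x).add ((hp x).const_mul δ))).sub (((hq x).pow 2).const_mul v)).sub
      (((hp x).mul (hq x)).const_mul (2 * v * δ))).congr_deriv ?_
    simp [P']
  have hflux : ∫ x in (0:ℝ)..1, P' x = 0 := by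
    rw [integral_eq_sub_of_hasDerivAt (fun x _ => hP x) (cP'.intervalIntegrable _ _)]
    simp [P, hp0, hp1, hq0, hq1]
  have hwirt : 0 ≤ ∫ x in (0:ℝ)..1, (r x ^ 2 - π ^ 2 * p x ^ 2) :=
    wirtinger_dirichlet hp cr hp0 hp1
  set c : ℝ := (ε + l) * (δ / (2 * π) + δ ^ 2 / π ^ 2) with hc
  have hc0 : 0 ≤ c := by positivity
  have cL : Continuous fun x => lyapunovDensity b δ η v (p x) (q x) (r x) := by
    unfold lyapunovDensity
    fun_prop
  have ch' : Continuous h' := by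
    rw [funext hh']
    fun_prop
  have i1 : IntervalIntegrable (fun x => -ε * lyapunovDensity b δ η v (p x) (q x) (r x))
      volume 0 1 := (cL.const_mul _).intervalIntegrable _ _
  have i2 : IntervalIntegrable (fun x => c * (r x ^ 2 - π ^ 2 * p x ^ 2)) volume 0 1 :=
    Continuous.intervalIntegrable (by fun_prop) _ _
  have i3 : IntervalIntegrable (fun x => f x ^ 2 / (2 * l)) volume 0 1 := hf.div_const _
  have i4 : IntervalIntegrable P' volume 0 1 := cP'.intervalIntegrable _ _
  have hmono : ∫ x in (0:ℝ)..1, h' x ≤ ∫ x in (0:ℝ)..1,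
      (-ε * lyapunovDensity b δ η v (p x) (q x) (r x) - c * (r x ^ 2 - π ^ 2 * p x ^ 2) +
        f x ^ 2 / (2 * l) + P' x) := by
    refine integral_mono_on_of_le_Ioo zero_le_one (ch'.intervalIntegrable _ _)
      (((i1.sub i2).add i3).add i4) fun x hx => ?_
    have hdis := dissipation_le_s16 hb hδ hη hv ha hε hl hρ hK1 hK2 hK3 (p x) (q x) (r x) (s x)
      (f x)
    have hid : h' x = -δ * q x ^ 2 + 2 * v * δ * r x * q x - δ * (1 - v ^ 2) * r x ^ 2 -
        δ * b / 2 * r x ^ 4 - η * r x ^ 2 * s x ^ 2 + f x * (q x + δ * p x) + P' x := by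
      rw [hh']
      simp only [P', S, S']
      linear_combination (q x + δ * p x) * hpde x hx
    rw [← hc] at hdis
    linarith
  rw [integral_add ((i1.sub i2).add i3) i4, integral_add (i1.sub i2) i3, integral_sub i1 i2,
    intervalIntegral.integral_const_mul, intervalIntegral.integral_const_mul,
    intervalIntegral.integral_div, hflux] at hmono
  linarith [mul_nonneg hc0 hwirt]

end

/-- BIBO stability of the forced Kelvin–Voigt moving string: for a bounded
(in the `X∞` sense) measurable distributed force `F`, the displacement of a
C³ solution starting from rest is bounded, with
`‖y‖_{X∞} ≤ √(K / (ε[(2δ − εK)(1 − v²) − 2δv])) ⬝ ‖F‖_{X₂}`.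
Here `‖F‖_{X₂} = sup_{t ≥ 0} (∫₀¹ F(x,t)² dx)^{1/2}` is realized as the
supremum (`sSup`) of the corresponding set of real numbers. -/
theorem stmt_16 (b δ η v : ℝ) (hb : 0 < b) (hδ : 0 < δ) (hη : 0 < η)
    (hv0 : 0 ≤ v) (hv1 : v < (Real.sqrt 5 - 1) / 2)
    (K : ℝ)
    (hK : K = 1 + δ * max ((1 + 2 * δ / π) / (π * (1 - v ^ 2))) (2 * η / b))
    (ε : ℝ) (hε0 : 0 < ε)
    (hε1 : ε < 2 * δ * (1 - v - v ^ 2) / (K * (1 - v ^ 2)))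
    (F : ℝ → ℝ → ℝ)
    (hFmeas : Measurable (Function.uncurry F))
    (hFbdd : ∃ M : ℝ, ∀ t : ℝ, 0 ≤ t → ∀ x ∈ Set.Ioo (0:ℝ) 1, |F x t| ≤ M)
    (y : ℝ → ℝ → ℝ)
    (hy : ContDiff ℝ 3 (Function.uncurry y))
    (hpde : ∀ x ∈ Set.Ioo (0:ℝ) 1, ∀ t : ℝ, 0 ≤ t →
      pdt (pdt y) x t + 2 * δ * pdt y x t + 2 * v * pdx (pdt y) x t
        = (1 - v ^ 2 + (3/2) * b * (pdx y x t) ^ 2) * pdx (pdx y) x t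
          + 2 * η * pdx y x t * pdx (pdx y) x t * pdx (pdt y) x t
          + η * (pdx y x t) ^ 2 * pdx (pdx (pdt y)) x t
          + F x t)
    (hbc : ∀ t : ℝ, 0 ≤ t → y 0 t = 0 ∧ y 1 t = 0)
    (hic : ∀ x ∈ Set.Ioo (0:ℝ) 1, y x 0 = 0 ∧ pdt y x 0 = 0) :
    ∀ t : ℝ, 0 ≤ t → ∀ x ∈ Set.Ioo (0:ℝ) 1,
      |y x t| ≤
        Real.sqrt (K / (ε * ((2 * δ - ε * K) * (1 - v ^ 2) - 2 * δ * v)))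
          * sSup {r : ℝ | ∃ s : ℝ, 0 ≤ s ∧
              r = Real.sqrt (∫ x' in (0:ℝ)..1, (F x' s) ^ 2)} := by
  obtain ⟨M, hM⟩ := hFbdd
  have hv2 : v + v ^ 2 < 1 := by
    have h5 : Real.sqrt 5 ^ 2 = 5 := Real.sq_sqrt (by norm_num)
    nlinarith [Real.sqrt_nonneg 5]
  have ha : 0 < 1 - v ^ 2 := by linarith
  obtain ⟨hK1, hK2, hK3⟩ := K_bounds (η := η) hb hδ ha hK
  have hK0 : 0 < K := by linarith [show 0 < δ / π by positivity]
  rw [lt_div_iff₀ (by positivity)] at hε1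
  obtain ⟨l, hl⟩ : ∃ l, l = 2 * δ * (1 - v - v ^ 2) / (K * (1 - v ^ 2)) - ε := ⟨_, rfl⟩
  have hρ : (ε + l) * K * (1 - v ^ 2) = 2 * δ * (1 - v - v ^ 2) := by
    rw [hl]
    field_simp
    ring
  have hl0 : 0 < l := by
    refine pos_of_mul_pos_left (b := K * (1 - v ^ 2)) ?_ (by positivity)
    linarith
  have hconst : K / (ε * ((2 * δ - ε * K) * (1 - v ^ 2) - 2 * δ * v)) =
      1 / (ε * l * (1 - v ^ 2)) := by
    have : (2 * δ - ε * K) * (1 - v ^ 2) - 2 * δ * v = K * (l * (1 - v ^ 2)) := by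
      linear_combination -hρ
    rw [this]
    field_simp
  have hy3 : ContDiff ℝ ((2 : ℕ) + 1) (Function.uncurry y) := by
    convert hy using 1
    norm_num
  have hp2 := contDiff_pdx hy3
  have hq2 := contDiff_pdt hy3
  have hy1 : ContDiff ℝ 1 (Function.uncurry y) := hy.of_le (by norm_num)
  have hp1 : ContDiff ℝ 1 (Function.uncurry (pdx y)) := hp2.of_le (by norm_num)
  have hq1 : ContDiff ℝ 1 (Function.uncurry (pdt y)) := hq2.of_le (by norm_num)
  have hs1 : ContDiff ℝ (1 : ℕ) (Function.uncurry (pdx (pdt y))) :=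
    contDiff_pdx (by simpa [one_add_one_eq_two] using hq2)
  have hqt1 : ContDiff ℝ (1 : ℕ) (Function.uncurry (pdt (pdt y))) :=
    contDiff_pdt (by simpa [one_add_one_eq_two] using hq2)
  have hr1 : ContDiff ℝ (1 : ℕ) (Function.uncurry (pdx (pdx y))) :=
    contDiff_pdx (by simpa [one_add_one_eq_two] using hp2)
  have hsx0 : ContDiff ℝ (0 : ℕ) (Function.uncurry (pdx (pdx (pdt y)))) :=
    contDiff_pdx (by simpa using hs1)
  have cy : Continuous fun z : ℝ × ℝ => y z.1 z.2 := hy.continuous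
  have cp : Continuous fun z : ℝ × ℝ => pdx y z.1 z.2 := hp1.continuous
  have cq : Continuous fun z : ℝ × ℝ => pdt y z.1 z.2 := hq1.continuous
  have cs : Continuous fun z : ℝ × ℝ => pdx (pdt y) z.1 z.2 := hs1.continuous
  have cqt : Continuous fun z : ℝ × ℝ => pdt (pdt y) z.1 z.2 := hqt1.continuous
  have slice : ∀ {u : ℝ → ℝ → ℝ}, Continuous (Function.uncurry u) → ∀ t,
      Continuous fun x => u x t :=
    fun hu t => hu.comp (by fun_prop : Continuous fun x : ℝ => (x, t))
  let h : ℝ → ℝ → ℝ := fun x t => lyapunovDensity b δ η v (y x t) (pdt y x t) (pdx y x t)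
  let h' : ℝ → ℝ → ℝ := fun x t => pdt y x t * pdt (pdt y) x t +
    (1 - v ^ 2) * pdx y x t * pdx (pdt y) x t + b / 2 * pdx y x t ^ 3 * pdx (pdt y) x t +
      δ * (pdt y x t * pdt y x t + y x t * pdt (pdt y) x t + 2 * δ * y x t * pdt y x t +
        η * pdx y x t ^ 3 * pdx (pdt y) x t)
  have ch : Continuous (Function.uncurry h) := by
    simp only [Function.uncurry_def, h, lyapunovDensity]
    fun_prop
  have ch' : Continuous (Function.uncurry h') := by
    simp only [Function.uncurry_def, h']
    fun_prop
  have hh : ∀ x t, HasDerivAt (fun t => h x t) (h' x t) t := by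
    intro x t
    have dy := hasDerivAt_pdt_s16 hy1 x t
    have dq := hasDerivAt_pdt_s16 hq1 x t
    have dr := hasDerivAt_pdt_s16 hp1 x t
    rw [pdt_pdx_comm (hy.of_le (by norm_num))] at dr
    refine (((((dq.pow 2).div_const 2).add ((dr.pow 2).const_mul ((1 - v ^ 2) / 2))).add
      ((dr.pow 4).const_mul (b / 8))).add ((((dy.mul dq).add ((dy.pow 2).const_mul δ)).add
        ((dr.pow 4).const_mul (η / 4))).const_mul δ)).congr_deriv ?_
    simp only [h']
    push_cast
    ring
  have hV := hasDerivAt_integral_of_continuous ch ch' hh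
  set m := sSup {r : ℝ | ∃ s : ℝ, 0 ≤ s ∧
              r = Real.sqrt (∫ x' in (0:ℝ)..1, (F x' s) ^ 2)} with hm
  have hm0 : 0 ≤ m := Real.sSup_nonneg (by rintro _ ⟨s, _, rfl⟩; exact Real.sqrt_nonneg _)
  have hV0 : ∫ x in (0:ℝ)..1, h x 0 = 0 := by
    rw [intervalIntegral.integral_congr_Ioo_of_le (g := fun _ => 0) zero_le_one fun x hx => ?_,
      intervalIntegral.integral_zero]
    simp [h, lyapunovDensity, (hic x hx).1, (hic x hx).2,
      pdx_eq_zero_of_forall (fun s hs => (hic s hs).1) hx]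
  have hV' : ∀ t, 0 < t →
      ∫ x in (0:ℝ)..1, h' x t ≤ -ε * (∫ x in (0:ℝ)..1, h x t) + m ^ 2 / (2 * l) := by
    intro t ht
    obtain ⟨hFi, hFm⟩ := intervalIntegrable_sq_and_le_sSup_sq hFmeas hM ht.le
    refine (integral_pdt_lyapunovDensity_le hb hδ hη hv0 ha hε0 hl0 hρ hK1 hK2 hK3
      (fun x => hasDerivAt_pdx_s16 hy1 x t) (fun x => hasDerivAt_pdx_s16 hq1 x t)
      (fun x => hasDerivAt_pdx_s16 hp1 x t) (fun x => hasDerivAt_pdx_s16 hs1 x t)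
      (slice hqt1.continuous t) (slice hr1.continuous t) (slice hsx0.continuous t)
      (fun x hx => hpde x hx t ht.le) (hbc t ht.le).1 (hbc t ht.le).2
      (pdt_eq_zero_of_forall (fun s hs => (hbc s hs).1) ht)
      (pdt_eq_zero_of_forall (fun s hs => (hbc s hs).2) ht) hFi (fun x => rfl)).trans ?_
    gcongr
  intro t ht x hx
  have hVt := le_div_of_deriv_le hε0 (by positivity) hV hV0 hV' ht
  have hsob := sq_le_integral_deriv_sq (fun x => hasDerivAt_pdx_s16 hy1 x t) (slice hp1.continuous t)
    (hbc t ht).1 hx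
  have hcoer : (1 - v ^ 2) / 2 * ∫ x in (0:ℝ)..1, pdx y x t ^ 2 ≤ ∫ x in (0:ℝ)..1, h x t := by
    rw [← intervalIntegral.integral_const_mul]
    exact intervalIntegral.integral_mono_on zero_le_one
      ((((slice hp1.continuous t).pow 2).const_mul _).intervalIntegrable _ _)
      ((slice ch t).intervalIntegrable _ _) fun x _ => mul_sq_le_lyapunovDensity hb hδ hη _ _ _
  have hsq : y x t ^ 2 ≤ 1 / (ε * l * (1 - v ^ 2)) * m ^ 2 := by
    have h1 : (1 - v ^ 2) / 2 * y x t ^ 2 ≤ m ^ 2 / (2 * l) / ε :=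
      (mul_le_mul_of_nonneg_left hsob (by positivity)).trans (hcoer.trans hVt)
    have h2 : 1 / (ε * l * (1 - v ^ 2)) * m ^ 2 = (m ^ 2 / (2 * l) / ε) / ((1 - v ^ 2) / 2) := by
      field_simp
    rw [h2, le_div_iff₀ (by positivity)]
    linarith
  rw [hconst, ← Real.sqrt_sq hm0, ← Real.sqrt_mul (by positivity)]
  exact Real.abs_le_sqrt hsq
end
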